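/- Let R be a commutative ring and X a cubical R-module. Under the identification C_nX = C_{n−1}SX, the positive connection subcomplex of C_*X equals the simplicial degeneracy subcomplex of SX shifted by one: posCon_nX = Deg_{n−1}SX for all n ≥ 1. Consequently the cubical Moore complex of X coincides with the simplicial Moore complex of SX shifted by one: for every n, X_n/B_n(X) = (the degree n−1 part of the simplicial Moore complex of SX), with equal differentials. -/

import Mathlib

/-- A cubical `R`-module (with connections): modules `X n` together with faces
`d n ε i : X (n+1) → X n` (meaningful for `1 ≤ i ≤ n+1`), degeneracies
`s n i : X n → X (n+1)` (for `1 ≤ i ≤ n+1`) and connections `γ n ε i : X n → X (n+1)`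
(for `1 ≤ i ≤ n`), subject to the cubical identities (C1)–(C6). -/
structure CubicalModule (R : Type) [CommRing R] where
  X : ℕ → Type
  [acg : ∀ n, AddCommGroup (X n)]
  [mdl : ∀ n, Module R (X n)]
  d : ∀ n : ℕ, Fin 2 → ℕ → (X (n + 1) →ₗ[R] X n)
  s : ∀ n : ℕ, ℕ → (X n →ₗ[R] X (n + 1))
  γ : ∀ n : ℕ, Fin 2 → ℕ → (X n →ₗ[R] X (n + 1))
  C1 : ∀ (n : ℕ) (ε η : Fin 2) (i j : ℕ), 1 ≤ j → j ≤ i → i ≤ n + 1 →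
    (d n ε i) ∘ₗ (d (n + 1) η j) = (d n η j) ∘ₗ (d (n + 1) ε (i + 1))
  C2a : ∀ (n : ℕ) (ε : Fin 2) (i j : ℕ), 1 ≤ j → j < i → i ≤ n + 2 →
    (d (n + 1) ε i) ∘ₗ (s (n + 1) j) = (s n j) ∘ₗ (d n ε (i - 1))
  C2b : ∀ (n : ℕ) (ε : Fin 2) (i : ℕ), 1 ≤ i → i ≤ n + 2 →
    (d (n + 1) ε i) ∘ₗ (s (n + 1) i) = LinearMap.id
  C2c : ∀ (n : ℕ) (ε : Fin 2) (i j : ℕ), 1 ≤ i → i < j → j ≤ n + 2 →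
    (d (n + 1) ε i) ∘ₗ (s (n + 1) j) = (s n (j - 1)) ∘ₗ (d n ε i)
  C3 : ∀ (n i j : ℕ), 1 ≤ j → j ≤ i → i ≤ n + 1 →
    (s (n + 1) j) ∘ₗ (s n i) = (s (n + 1) (i + 1)) ∘ₗ (s n j)
  C4a : ∀ (n : ℕ) (ε η : Fin 2) (i j : ℕ), 1 ≤ j → j < i → i ≤ n →
    (γ (n + 1) ε j) ∘ₗ (γ n η i) = (γ (n + 1) η (i + 1)) ∘ₗ (γ n ε j)
  C4b : ∀ (n : ℕ) (ε : Fin 2) (i : ℕ), 1 ≤ i → i ≤ n →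
    (γ (n + 1) ε i) ∘ₗ (γ n ε i) = (γ (n + 1) ε (i + 1)) ∘ₗ (γ n ε i)
  C5a : ∀ (n : ℕ) (ε η : Fin 2) (i j : ℕ), 1 ≤ j → j + 1 < i → i ≤ n + 2 →
    (d (n + 1) ε i) ∘ₗ (γ (n + 1) η j) = (γ n η j) ∘ₗ (d n ε (i - 1))
  C5b : ∀ (n : ℕ) (ε : Fin 2) (j : ℕ), 1 ≤ j → j ≤ n + 1 →
    (d (n + 1) ε j) ∘ₗ (γ (n + 1) ε j) = LinearMap.id ∧
      (d (n + 1) ε (j + 1)) ∘ₗ (γ (n + 1) ε j) = LinearMap.id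
  C5c : ∀ (n : ℕ) (ε : Fin 2) (j : ℕ), 1 ≤ j → j ≤ n + 1 →
    (d (n + 1) ε j) ∘ₗ (γ (n + 1) (1 - ε) j) = (s n j) ∘ₗ (d n ε j) ∧
      (d (n + 1) ε (j + 1)) ∘ₗ (γ (n + 1) (1 - ε) j) = (s n j) ∘ₗ (d n ε j)
  C5d : ∀ (n : ℕ) (ε η : Fin 2) (i j : ℕ), 1 ≤ i → i < j → j ≤ n + 1 →
    (d (n + 1) ε i) ∘ₗ (γ (n + 1) η j) = (γ n η (j - 1)) ∘ₗ (d n ε i)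
  C6a : ∀ (n : ℕ) (ε : Fin 2) (i j : ℕ), 1 ≤ j → j < i → i ≤ n + 1 →
    (γ (n + 1) ε i) ∘ₗ (s n j) = (s (n + 1) j) ∘ₗ (γ n ε (i - 1))
  C6b : ∀ (n : ℕ) (ε : Fin 2) (i : ℕ), 1 ≤ i → i ≤ n + 1 →
    (γ (n + 1) ε i) ∘ₗ (s n i) = (s (n + 1) i) ∘ₗ (s n i)
  C6c : ∀ (n : ℕ) (ε : Fin 2) (i j : ℕ), 1 ≤ i → i < j → j ≤ n + 1 →
    (γ (n + 1) ε i) ∘ₗ (s n j) = (s (n + 1) (j + 1)) ∘ₗ (γ n ε i)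

attribute [instance] CubicalModule.acg CubicalModule.mdl

/-- The submodule of degenerate elements: for `n ≥ 1` it is generated by the images of the
degeneracies `s_i : X_{n-1} → X_n`, `1 ≤ i ≤ n`. -/
def CubicalModule.cDeg {R : Type} [CommRing R] (Y : CubicalModule R) :
    ∀ n : ℕ, Submodule R (Y.X n)
  | 0 => ⊥
  | (n + 1) => ⨆ i ∈ Finset.Icc 1 (n + 1), LinearMap.range (Y.s n i)

/-- The chain group `C_nX = X_n / cDeg_n(X)` of the cubical alternating face map complex. -/
abbrev CubicalModule.CC {R : Type} [CommRing R] (Y : CubicalModule R) (n : ℕ) :=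
  Y.X n ⧸ Y.cDeg n

/-- The alternating face map `∂_{n+1} = ∑_{i=1}^{n+1} (-1)^{i-1} (d_i^0 - d_i^1)` on
the underlying modules. -/
def CubicalModule.δ {R : Type} [CommRing R] (Y : CubicalModule R) (n : ℕ) :
    Y.X (n + 1) →ₗ[R] Y.X n :=
  ∑ i ∈ Finset.Icc 1 (n + 1), ((-1 : R) ^ (i - 1)) • (Y.d n 0 i - Y.d n 1 i)

/-- The submodule `B_n(X) ⊆ X_n` generated by the images of the degeneracies and of the
positive connections. -/
def CubicalModule.Bsub {R : Type} [CommRing R] (Y : CubicalModule R) :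
    ∀ n : ℕ, Submodule R (Y.X n)
  | 0 => ⊥
  | (n + 1) =>
      (⨆ i ∈ Finset.Icc 1 (n + 1), LinearMap.range (Y.s n i)) ⊔
        (⨆ i ∈ Finset.Icc 1 n, LinearMap.range (Y.γ n 0 i))

/-- under the identification `C_nX = C_{n-1}SX`, the positive connection
subcomplex of `C_*X` equals the simplicial degeneracy subcomplex of `SX` shifted by one,
and consequently the cubical Moore complex of `X` coincides with the simplicial Moore
complex of `SX` shifted by one, with equal differentials. -/
theorem stmt11 {R : Type} [CommRing R] (Y : CubicalModule R)
    -- the simplicial face maps of `SX`, induced by `d_{i+1}^0 - d_{i+1}^1`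
    (dΔ : ∀ n : ℕ, ℕ → (Y.CC (n + 1) →ₗ[R] Y.CC n))
    (hdΔ : ∀ n i : ℕ, i ≤ n →
      (dΔ n i) ∘ₗ (Y.cDeg (n + 1)).mkQ =
        (Y.cDeg n).mkQ ∘ₗ (Y.d n 0 (i + 1) - Y.d n 1 (i + 1)))
    -- the simplicial degeneracies of `SX`, induced by the positive connections `γ_{i+1}^0`
    (sΔ : ∀ n : ℕ, ℕ → (Y.CC n →ₗ[R] Y.CC (n + 1)))
    (hsΔ : ∀ n i : ℕ, i + 1 ≤ n →
      (sΔ n i) ∘ₗ (Y.cDeg n).mkQ = (Y.cDeg (n + 1)).mkQ ∘ₗ (Y.γ n 0 (i + 1)))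
    -- the maps induced on the quotients by the positive connections `γ_i^0`
    (γQ : ∀ n : ℕ, ℕ → (Y.CC n →ₗ[R] Y.CC (n + 1)))
    (hγQ : ∀ n i : ℕ, 1 ≤ i → i ≤ n →
      (γQ n i) ∘ₗ (Y.cDeg n).mkQ = (Y.cDeg (n + 1)).mkQ ∘ₗ (Y.γ n 0 i)) :
    -- `posCon_{n+1}X = Deg_n SX` as submodules of `C_{n+1}X = C_nSX`
    (∀ n : ℕ,
      (⨆ i ∈ Finset.Icc 1 n, LinearMap.range (γQ n i)) =
        ⨆ i ∈ Finset.range n, LinearMap.range (sΔ n i)) ∧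
    -- `B_n(X)` is the preimage of `Deg_{n-1}SX` under the quotient map
    -- `X_n → C_nX = C_{n-1}SX`; hence `X_n/B_n(X)` coincides with the degree `n-1` part
    -- `C_{n-1}SX / Deg_{n-1}SX` of the simplicial Moore complex of `SX`
    (∀ n : ℕ,
      Y.Bsub (n + 1) =
        Submodule.comap (Y.cDeg (n + 1)).mkQ
          (⨆ i ∈ Finset.range n, LinearMap.range (sΔ n i))) ∧
    -- the differentials of the two Moore complexes agree under this identification
    (∀ (n : ℕ) (x : Y.X (n + 2)),
      (∑ i ∈ Finset.range (n + 2), ((-1 : R) ^ i) • dΔ (n + 1) i)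
          ((Y.cDeg (n + 2)).mkQ x) -
        (Y.cDeg (n + 1)).mkQ (Y.δ (n + 1) x) ∈
        ⨆ i ∈ Finset.range n, LinearMap.range (sΔ n i)) := by
  have key : ∀ n i : ℕ, i + 1 ≤ n → LinearMap.range (sΔ n i) =
      Submodule.map (Y.cDeg (n + 1)).mkQ (LinearMap.range (Y.γ n 0 (i + 1))) := by
    intro n i h
    rw [← LinearMap.range_comp, ← hsΔ n i h,
      LinearMap.range_comp_of_range_eq_top _ (Submodule.range_mkQ _)]
  have key2 : ∀ n i : ℕ, 1 ≤ i → i ≤ n → LinearMap.range (γQ n i) =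
      Submodule.map (Y.cDeg (n + 1)).mkQ (LinearMap.range (Y.γ n 0 i)) := by
    intro n i h h'
    rw [← LinearMap.range_comp, ← hγQ n i h h',
      LinearMap.range_comp_of_range_eq_top _ (Submodule.range_mkQ _)]
  have part1 : ∀ n : ℕ,
      (⨆ i ∈ Finset.Icc 1 n, LinearMap.range (γQ n i)) =
        ⨆ i ∈ Finset.range n, LinearMap.range (sΔ n i) := by
    intro n
    apply le_antisymm
    · refine iSup₂_le fun i hi => ?_
      rw [Finset.mem_Icc] at hi
      obtain ⟨j, rfl⟩ : ∃ j, i = j + 1 := ⟨i - 1, by omega⟩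
      rw [key2 n _ hi.1 hi.2, ← key n j hi.2]
      exact le_iSup₂_of_le j (Finset.mem_range.2 (by omega)) le_rfl
    · refine iSup₂_le fun i hi => ?_
      rw [Finset.mem_range] at hi
      rw [key n i (by omega), ← key2 n (i + 1) (by omega) (by omega)]
      exact le_iSup₂_of_le (i + 1) (Finset.mem_Icc.2 (by omega)) le_rfl
  refine ⟨part1, ?_, ?_⟩
  · intro n
    have h : (⨆ i ∈ Finset.Icc 1 n, LinearMap.range (γQ n i)) =
        Submodule.map (Y.cDeg (n + 1)).mkQ
          (⨆ i ∈ Finset.Icc 1 n, LinearMap.range (Y.γ n 0 i)) := by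
      simp only [Submodule.map_iSup]
      refine iSup_congr fun i => iSup_congr fun hi => ?_
      rw [Finset.mem_Icc] at hi
      exact key2 n i hi.1 hi.2
    rw [← part1 n, h, Submodule.comap_map_mkQ]
    rfl
  · intro n x
    have h : (∑ i ∈ Finset.range (n + 2), ((-1 : R) ^ i) • dΔ (n + 1) i)
          ((Y.cDeg (n + 2)).mkQ x) = (Y.cDeg (n + 1)).mkQ (Y.δ (n + 1) x) := by
      have hI : Finset.Icc 1 (n + 1 + 1) = (Finset.range (n + 2)).image (· + 1) := by
        ext i
        simp only [Finset.mem_Icc, Finset.mem_image, Finset.mem_range]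
        constructor
        · intro hi
          exact ⟨i - 1, by omega, by omega⟩
        · rintro ⟨j, hj, rfl⟩
          omega
      rw [CubicalModule.δ, hI, Finset.sum_image (by intro a _ b _ hab; simpa using hab)]
      rw [LinearMap.sum_apply, LinearMap.sum_apply, map_sum]
      refine Finset.sum_congr rfl fun i hi => ?_
      rw [Finset.mem_range] at hi
      have := LinearMap.congr_fun (hdΔ (n + 1) i (by omega)) x
      rw [LinearMap.comp_apply, LinearMap.comp_apply] at this
      rw [LinearMap.smul_apply, LinearMap.smul_apply, map_smul, this, Nat.add_sub_cancel]
    rw [h, sub_self]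
    exact Submodule.zero_mem _
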